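/- Let λ ∈ ℝ, let z, ẑ ∈ ℂ with z ≠ λ and ẑ ≠ λ, let J be an interval, let u₋ : J → ℝ², let c : J → ℝ with c(x) ≠ 0 for all x, and let u, û : J → ℂ². Define v(x) = u(x) + (u₋(x)/((z−λ)·c(x)))·W_x(u₋,u) and v̂(x) = û(x) + (u₋(x)/((ẑ−λ)·c(x)))·W_x(u₋,û). Then for every x ∈ J, W_x(v,v̂) = W_x(u,û) − (1/c(x))·((z−ẑ)/((z−λ)(ẑ−λ)))·W_x(u₋,u)·W_x(u₋,û). -/

import Mathlib

noncomputable section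

/-- The Wronskian `W(f,g) = f₁g₂ - f₂g₁` of two vectors in `ℂ²`. -/
def Wr (f g : ℂ × ℂ) : ℂ := f.1 * g.2 - f.2 * g.1

/-- Embedding of `ℝ²` into `ℂ²`. -/
def toC (v : ℝ × ℝ) : ℂ × ℂ := ((v.1 : ℂ), (v.2 : ℂ))

/-- The Wronskian identity for the double commutation method: if
`v = u + (u₋/((z-λ)c))·W(u₋,u)` and `v̂ = û + (u₋/((ẑ-λ)c))·W(u₋,û)`, then
`W(v,v̂) = W(u,û) - (1/c)·((z-ẑ)/((z-λ)(ẑ-λ)))·W(u₋,u)·W(u₋,û)`. -/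
theorem double_commutation_wronskian_identity
    (lam : ℝ) (z zh : ℂ) (hz : z ≠ (lam : ℂ)) (hzh : zh ≠ (lam : ℂ))
    (J : Set ℝ) (um : ℝ → ℝ × ℝ)
    (c : ℝ → ℝ) (hc0 : ∀ x ∈ J, c x ≠ 0)
    (u uh v vh : ℝ → ℂ × ℂ)
    (hv : ∀ x ∈ J,
      v x = u x + ((Wr (toC (um x)) (u x)) / ((z - (lam : ℂ)) * (c x : ℂ))) • toC (um x))
    (hvh : ∀ x ∈ J,
      vh x = uh x + ((Wr (toC (um x)) (uh x)) / ((zh - (lam : ℂ)) * (c x : ℂ))) • toC (um x)) :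
    ∀ x ∈ J,
      Wr (v x) (vh x) = Wr (u x) (uh x)
        - ((c x : ℂ))⁻¹ * ((z - zh) / ((z - (lam : ℂ)) * (zh - (lam : ℂ))))
          * Wr (toC (um x)) (u x) * Wr (toC (um x)) (uh x) := by
  intro x hx
  have h1 : z - (lam : ℂ) ≠ 0 := sub_ne_zero.mpr hz
  have h2 : zh - (lam : ℂ) ≠ 0 := sub_ne_zero.mpr hzh
  have h3 : (c x : ℂ) ≠ 0 := by exact_mod_cast hc0 x hx
  rw [hv x hx, hvh x hx]
  simp only [Wr, toC, Prod.fst_add, Prod.snd_add, Prod.smul_fst, Prod.smul_snd, smul_eq_mul]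
  field_simp
  ring
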